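/- Let N = (B,E,F) be a locally finite causal net with X = B ∪ E. Then N is K-dense if and only if for every closed set A ⊆ X and every line λ of N, either λ ∩ A ≠ ∅ or λ ∩ A' ≠ ∅. -/

import Mathlib

/-- A causal net `N = (B, E, F)`: conditions `B` and events `E` are disjoint
countable sets covering the carrier, `F ⊆ (B × E) ∪ (E × B)` is the flow
relation, every element is in `dom F ∪ ran F`, every condition has at most one
`F`-predecessor and at most one `F`-successor, and `F⁺` is irreflexive. -/
structure CausalNet (α : Type*) where
  B : Set α
  E : Set α
  F : α → α → Prop
  countable_B : B.Countable
  countable_E : E.Countable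
  disjoint_BE : Disjoint B E
  cover : B ∪ E = Set.univ
  bipartite : ∀ x y, F x y → (x ∈ B ∧ y ∈ E) ∨ (x ∈ E ∧ y ∈ B)
  no_isolated : ∀ x, (∃ y, F x y) ∨ (∃ y, F y x)
  pred_subsingleton : ∀ b ∈ B, {e | F e b}.Subsingleton
  succ_subsingleton : ∀ b ∈ B, {e | F b e}.Subsingleton
  acyclic : ∀ x, ¬ Relation.TransGen F x x

namespace CausalNet

variable {α : Type*} (N : CausalNet α)

/-- The causal order `⊑ = F*` (reflexive-transitive closure of `F`). -/
def le (x y : α) : Prop := Relation.ReflTransGen N.F x y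

/-- `li = ⊑ ∪ ⊒`: causal relatedness. -/
def li (x y : α) : Prop := N.le x y ∨ N.le y x

/-- `co = (X × X) \ li`: concurrency (causal independence). -/
def co (x y : α) : Prop := ¬ N.li x y

/-- `A' = {x | ∀ y ∈ A, x co y}`, the orthocomplement of `A`. -/
def prime (A : Set α) : Set α := {x | ∀ y ∈ A, N.co x y}

/-- `A` is closed iff `A = A''`. -/
def Closed (A : Set α) : Prop := A = N.prime (N.prime A)

/-- A line is a maximal clique of `li`. -/
def IsLine (l : Set α) : Prop :=
  l.Pairwise N.li ∧ ∀ m : Set α, m.Pairwise N.li → l ⊆ m → m = l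

/-- A cut is a maximal clique of `co ∪ id`, i.e. a maximal antichain. -/
def IsCut (c : Set α) : Prop :=
  c.Pairwise N.co ∧ ∀ m : Set α, m.Pairwise N.co → c ⊆ m → m = c

/-- K-density: every cut meets every line. -/
def KDense : Prop :=
  ∀ c l : Set α, N.IsCut c → N.IsLine l → (c ∩ l).Nonempty

/-- The interval `[x, y] = {z | x ⊑ z ⊑ y}`. -/
def interval (x y : α) : Set α := {z | N.le x z ∧ N.le z y}

/-- Local finiteness: intervals are finite and every element has finitely many
immediate `F`-predecessors and immediate `F`-successors. -/
def LocallyFinite : Prop :=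
  (∀ x y, (N.interval x y).Finite) ∧
  (∀ x, {y | N.F y x}.Finite) ∧ (∀ x, {y | N.F x y}.Finite)

/-- A B-cut of a subset `S`: a maximal antichain of `(S, ⊑)` consisting only of
conditions. -/
def IsBCutOf (S τ : Set α) : Prop :=
  τ ⊆ S ∧ τ ⊆ N.B ∧ τ.Pairwise N.co ∧
  ∀ m : Set α, m ⊆ S → m.Pairwise N.co → τ ⊆ m → m = τ

/-- Preconditions `•e` of an event. -/
def pre (e : α) : Set α := {b | N.F b e}

/-- Postconditions `e•` of an event. -/
def post (e : α) : Set α := {b | N.F e b}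

/-- Causally closed sets (Definition of `CC(N)`). -/
def CausallyClosed (C : Set α) : Prop :=
  (∀ e ∈ N.E, N.pre e ⊆ C → e ∈ C) ∧
  (∀ e ∈ N.E, N.post e ⊆ C → e ∈ C) ∧
  (∀ e ∈ N.E, e ∈ C → N.pre e ∪ N.post e ⊆ C) ∧
  (∀ x ∈ C, ∀ y ∈ C, N.li x y → N.interval x y ⊆ C)

end CausalNet

namespace CausalNet

variable {α : Type*} {N : CausalNet α}

theorem le_antisymm {x y : α} (h₁ : N.le x y) (h₂ : N.le y x) : x = y := by
  rcases Relation.reflTransGen_iff_eq_or_transGen.1 h₁ with h | h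
  · exact h.symm
  · exact (N.acyclic x (Relation.TransGen.trans_left h h₂)).elim

theorem le_trans {x y z : α} (h₁ : N.le x y) (h₂ : N.le y z) : N.le x z :=
  Relation.ReflTransGen.trans h₁ h₂

theorem le_refl (x : α) : N.le x x := Relation.ReflTransGen.refl

theorem li_symm {x y : α} (h : N.li x y) : N.li y x := Or.symm h

theorem mem_B_or_mem_E (N : CausalNet α) (x : α) : x ∈ N.B ∨ x ∈ N.E := by
  have h : x ∈ N.B ∪ N.E := N.cover ▸ Set.mem_univ x
  exact h

/-- The causal order `⊑` as a partial order. -/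
@[reducible] def toPartialOrder (N : CausalNet α) : PartialOrder α where
  le := N.le
  le_refl := le_refl
  le_trans _ _ _ := le_trans
  le_antisymm _ _ := le_antisymm

/-- The net with the flow relation reversed. -/
def op (N : CausalNet α) : CausalNet α where
  B := N.B
  E := N.E
  F := Function.swap N.F
  countable_B := N.countable_B
  countable_E := N.countable_E
  disjoint_BE := N.disjoint_BE
  cover := N.cover
  bipartite x y h := (N.bipartite y x h).symm.imp And.symm And.symm
  no_isolated x := (N.no_isolated x).symm
  pred_subsingleton := N.succ_subsingleton
  succ_subsingleton := N.pred_subsingleton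
  acyclic x h := N.acyclic x (Relation.transGen_swap.1 h)

theorem le_op {x y : α} : N.op.le x y ↔ N.le y x := Relation.reflTransGen_swap

theorem li_op : N.op.li = N.li := by
  ext x y
  simp only [li, le_op]
  exact or_comm

theorem co_op : N.op.co = N.co := by
  ext x y
  simp only [co, li_op]

theorem prime_op : N.op.prime = N.prime := by
  ext A x
  simp only [prime, co_op]

theorem isLine_op {l : Set α} : N.op.IsLine l ↔ N.IsLine l := by
  simp only [IsLine, li_op]

theorem finite_interval_op (h : ∀ x y, (N.interval x y).Finite) (x y : α) :
    (N.op.interval x y).Finite := by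
  refine (h y x).subset fun z hz => ?_
  simp only [interval, le_op, Set.mem_ofPred_eq] at hz ⊢
  exact hz.symm

theorem prime_antitone {A C : Set α} (h : A ⊆ C) : N.prime C ⊆ N.prime A :=
  fun _ hx y hy => hx y (h hy)

theorem subset_prime_prime (A : Set α) : A ⊆ N.prime (N.prime A) :=
  fun _ hx _ hy h => hy _ hx (li_symm h)

theorem closed_prime (S : Set α) : N.Closed (N.prime S) :=
  (subset_prime_prime _).antisymm (prime_antitone (subset_prime_prime S))

theorem mem_prime_of_le_of_le {S : Set α} {x y z : α} (hx : x ∈ N.prime S) (hz : z ∈ N.prime S)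
    (hxy : N.le x y) (hyz : N.le y z) : y ∈ N.prime S := by
  rintro s hs (h | h)
  · exact hx s hs (Or.inl (le_trans hxy h))
  · exact hz s hs (Or.inr (le_trans h hyz))

/-- Preconditions of an event in an orthocomplement belong to it. -/
theorem pre_subset_prime {S : Set α} {b e : α} (he : e ∈ N.E) (heS : e ∈ N.prime S)
    (hbe : N.F b e) : b ∈ N.prime S := by
  have hb : b ∈ N.B := by
    rcases N.bipartite b e hbe with h | h
    · exact h.1
    · exact (Set.disjoint_left.1 N.disjoint_BE h.2 he).elim
  have hle : N.le b e := Relation.ReflTransGen.single hbe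
  rintro s hs (h | h)
  · rcases Relation.ReflTransGen.cases_head h with rfl | ⟨w, hw, hws⟩
    · exact heS _ hs (Or.inr hle)
    · obtain rfl := N.succ_subsingleton b hb hw hbe
      exact heS _ hs (Or.inl hws)
  · exact heS _ hs (Or.inr (le_trans h hle))

theorem mem_prime_or_exists_le {S τ : Set α} (hτS : τ ⊆ N.prime S)
    (hτ : ∀ y ∈ N.prime S, ∃ b ∈ τ, N.li y b) {x y : α} (hxy : N.le x y)
    (hy : y ∈ N.prime S) : x ∈ N.prime S ∨ ∃ b ∈ τ, N.le x b := by
  induction hxy using Relation.ReflTransGen.head_induction_on with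
  | refl => exact Or.inl hy
  | @head x w hxw _ ih =>
    have hle : N.le x w := Relation.ReflTransGen.single hxw
    rcases ih with hw | ⟨b, hb, hwb⟩
    · rcases N.mem_B_or_mem_E w with hwB | hwE
      · obtain ⟨b, hb, h | h⟩ := hτ w hw
        · exact Or.inr ⟨b, hb, le_trans hle h⟩
        · rcases Relation.ReflTransGen.cases_tail h with rfl | ⟨v, hbv, hvw⟩
          · exact Or.inr ⟨_, hb, hle⟩
          · obtain rfl := N.pred_subsingleton w hwB hvw hxw
            exact Or.inl (mem_prime_of_le_of_le (hτS hb) hw hbv hle)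
      · exact Or.inl (pre_subset_prime hwE hw hxw)
    · exact Or.inr ⟨b, hb, le_trans hle hwb⟩

/-- A maximal antichain of an orthocomplement has the same orthocomplement. -/
theorem prime_eq_of_forall_exists_li {S τ : Set α} (hτS : τ ⊆ N.prime S)
    (hτ : ∀ y ∈ N.prime S, ∃ b ∈ τ, N.li y b) : N.prime τ = N.prime (N.prime S) := by
  refine Set.Subset.antisymm (fun x hx y hy hxy => ?_) (prime_antitone hτS)
  have key : x ∈ N.prime S ∨ ∃ b ∈ τ, N.li x b := by
    rcases hxy with h | h
    · exact (mem_prime_or_exists_le hτS hτ h hy).imp_right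
        fun ⟨b, hb, hxb⟩ => ⟨b, hb, Or.inl hxb⟩
    · refine (mem_prime_or_exists_le (N := N.op) (S := S) (τ := τ) (y := y) ?_ ?_
        (le_op.2 h) ?_).imp ?_ ?_
      · rwa [prime_op]
      · rwa [prime_op, li_op]
      · rwa [prime_op]
      · rw [prime_op]
        exact id
      · exact fun ⟨b, hb, hxb⟩ => ⟨b, hb, Or.inr (le_op.1 hxb)⟩
  obtain ⟨b, hb, hxb⟩ := key.elim (hτ x) id
  exact hx b hb hxb

theorem pairwise_co_insert {τ : Set α} {x : α} (hτ : τ.Pairwise N.co)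
    (hx : ∀ b ∈ τ, ¬ N.li x b) : (insert x τ).Pairwise N.co :=
  hτ.insert fun b hb _ => ⟨hx b hb, fun h => hx b hb (li_symm h)⟩

theorem exists_maximal_antichain (N : CausalNet α) (A : Set α) :
    ∃ τ ⊆ A, τ.Pairwise N.co ∧ ∀ y ∈ A, ∃ b ∈ τ, N.li y b := by
  obtain ⟨τ, hτ⟩ := zorn_subset {τ : Set α | τ ⊆ A ∧ τ.Pairwise N.co} fun c hc hch =>
    ⟨⋃₀ c, ⟨Set.sUnion_subset fun s hs => (hc hs).1,
      (Set.pairwise_sUnion hch.directedOn).2 fun s hs => (hc hs).2⟩,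
      fun _ => Set.subset_sUnion_of_mem⟩
  refine ⟨τ, hτ.prop.1, hτ.prop.2, fun y hy => ?_⟩
  by_contra! h
  have hyτ : y ∈ τ := hτ.le_of_ge
    ⟨Set.insert_subset hy hτ.prop.1, pairwise_co_insert hτ.prop.2 h⟩
    (Set.subset_insert y τ) (Set.mem_insert y τ)
  exact h y hyτ (Or.inl (le_refl y))

theorem IsCut.exists_li {c : Set α} (hc : N.IsCut c) (x : α) : ∃ b ∈ c, N.li x b := by
  by_contra! h
  have hx : x ∈ c :=
    hc.2 _ (pairwise_co_insert hc.1 h) (Set.subset_insert x c) ▸ Set.mem_insert x c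
  exact h x hx (Or.inl (le_refl x))

theorem isCut_of_forall_exists_li {c : Set α} (hc : c.Pairwise N.co)
    (h : ∀ x, ∃ b ∈ c, N.li x b) : N.IsCut c := by
  refine ⟨hc, fun m hm hcm => Set.Subset.antisymm (fun x hx => ?_) hcm⟩
  obtain ⟨b, hb, hxb⟩ := h x
  by_cases hne : x = b
  · exact hne ▸ hb
  · exact (hm hx (hcm hb) hne hxb).elim

theorem IsLine.mem_of_forall_li {l : Set α} (hl : N.IsLine l) {x : α}
    (h : ∀ y ∈ l, N.li x y) : x ∈ l :=
  hl.2 _ (hl.1.insert fun y hy _ => ⟨h y hy, li_symm (h y hy)⟩) (Set.subset_insert x l) ▸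
    Set.mem_insert x l

theorem IsLine.li {l : Set α} (hl : N.IsLine l) {x y : α} (hx : x ∈ l) (hy : y ∈ l) :
    N.li x y := by
  by_cases h : x = y
  · exact Or.inl (h ▸ le_refl x)
  · exact hl.1 hx hy h

theorem KDense.line_meets {A l : Set α} (hN : N.KDense) (hA : N.Closed A) (hl : N.IsLine l) :
    (l ∩ A).Nonempty ∨ (l ∩ N.prime A).Nonempty := by
  obtain ⟨σ, hσA, hσ, hσm⟩ := N.exists_maximal_antichain A
  obtain ⟨τ, hτA, hτ, hτm⟩ := N.exists_maximal_antichain (N.prime A)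
  have hσ' : N.prime σ = N.prime A := by
    have := prime_eq_of_forall_exists_li (N := N) (S := N.prime A) (τ := σ)
    rw [← hA] at this
    exact this hσA hσm
  have hτ' : N.prime τ = A := (prime_eq_of_forall_exists_li hτA hτm).trans hA.symm
  have hcut : N.IsCut (σ ∪ τ) := by
    refine isCut_of_forall_exists_li ?_ fun x => ?_
    · exact Set.pairwise_union.2 ⟨hσ, hτ, fun a ha b hb _ =>
        ⟨fun h => hτA hb a (hσA ha) (li_symm h), hτA hb a (hσA ha)⟩⟩
    · by_contra! h
      have h₁ : x ∈ N.prime A := hσ' ▸ fun b hb => h b (Or.inl hb)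
      have h₂ : x ∈ A := hτ' ▸ fun b hb => h b (Or.inr hb)
      exact h₁ x h₂ (Or.inl (le_refl x))
  obtain ⟨x, hx | hx, hxl⟩ := hN _ l hcut hl
  · exact Or.inl ⟨x, hxl, hσA hx⟩
  · exact Or.inr ⟨x, hxl, hτA hx⟩

/-- A line lying strictly below an antichain misses some orthocomplement and its
orthocomplement. -/
theorem exists_prime_disjoint_line (hfin : ∀ x y, (N.interval x y).Finite) {c l : Set α}
    (hc : c.Pairwise N.co) (hl : N.IsLine l) (hcl : ∀ z ∈ c, z ∉ l) (hne : l.Nonempty)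
    (hbelow : ∀ x ∈ l, ∃ z ∈ c, N.le x z) :
    ∃ S, ¬ (l ∩ N.prime S).Nonempty ∧ ¬ (l ∩ N.prime (N.prime S)).Nonempty := by
  let := N.toPartialOrder
  have step : ∀ x : l, ∃ z ∈ c, x.1 ≤ z ∧ ∃ u : l, x < u ∧ ¬ u.1 ≤ z := by
    rintro ⟨x, hx⟩
    obtain ⟨z, hz, hxz⟩ := hbelow x hx
    have : ∃ u ∈ l, ¬ N.li z u := by
      by_contra! h
      exact hcl z hz (hl.mem_of_forall_li h)
    obtain ⟨u, hu, hzu⟩ := this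
    have hux : ¬ u ≤ x := fun h => hzu (Or.inr (le_trans h hxz))
    have hxu : x ≤ u := (hl.li hx hu).resolve_right hux
    exact ⟨z, hz, hxz, ⟨u, hu⟩, lt_of_le_not_ge hxu hux, fun h => hzu (Or.inr h)⟩
  choose f hfc hf g hg hgf using step
  obtain ⟨x₀, hx₀⟩ := hne
  let x : ℕ → l := fun n => g^[n] ⟨x₀, hx₀⟩
  have hxs : ∀ n, x (n + 1) = g (x n) := fun n => Function.iterate_succ_apply' g n _
  have hx : StrictMono x := strictMono_nat_of_lt_succ fun n => hxs n ▸ hg (x n)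
  have hinj : Function.Injective fun n => f (x n) := by
    have hlt : ∀ i j, i < j → f (x i) ≠ f (x j) := by
      intro i j hij h
      refine hgf (x i) ?_
      rw [h, ← hxs]
      exact _root_.le_trans (hx.monotone (Nat.succ_le_of_lt hij)) (hf (x j))
    intro i j h
    rcases lt_trichotomy i j with hij | hij | hij
    · exact (hlt i j hij h).elim
    · exact hij
    · exact (hlt j i hij h.symm).elim
  have hcof : ∀ y ∈ l, ∃ n, y ≤ (x n).1 := by
    intro y hy
    by_contra! h
    refine Set.infinite_range_of_injective (Subtype.val_injective.comp hx.injective)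
      ((hfin (x 0).1 y).subset ?_)
    rintro _ ⟨n, rfl⟩
    exact ⟨hx.monotone (Nat.zero_le n), (hl.li hy (x n).2).resolve_left (h n)⟩
  refine ⟨Set.range fun n => f (x (2 * n)), ?_, ?_⟩
  · rintro ⟨y, hy, hyS⟩
    obtain ⟨n, hn⟩ := hcof y hy
    exact hyS _ ⟨n, rfl⟩ (Or.inl (_root_.le_trans hn
      (_root_.le_trans (hx.monotone (by omega : n ≤ 2 * n)) (hf (x (2 * n))))))
  · rintro ⟨y, hy, hyS⟩
    obtain ⟨n, hn⟩ := hcof y hy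
    refine hyS (f (x (2 * n + 1))) ?_ (Or.inl (_root_.le_trans hn
      (_root_.le_trans (hx.monotone (by omega : n ≤ 2 * n + 1)) (hf (x (2 * n + 1))))))
    rintro _ ⟨k, rfl⟩
    refine hc (hfc _) (hfc _) fun h => ?_
    have := hinj h
    omega

/-- In an interval-finite net, a line with points both below and above an antichain that
dominates it meets the antichain. -/
theorem IsLine.meets_of_le_of_le (hfin : ∀ x y, (N.interval x y).Finite) {c l : Set α}
    (hc : c.Pairwise N.co) (hl : N.IsLine l) (hli : ∀ x ∈ l, ∃ z ∈ c, N.li x z)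
    {p q : α} (hp : p ∈ l) (hq : q ∈ l) (hpc : ∃ z ∈ c, N.le p z) (hqc : ∃ z ∈ c, N.le z q) :
    (c ∩ l).Nonempty := by
  by_contra hcl
  have hcl : ∀ z ∈ c, z ∉ l := fun z hz hzl => hcl ⟨z, hz, hzl⟩
  let := N.toPartialOrder
  have hsep : ∀ u ∈ l, ∀ v ∈ l, (∃ z ∈ c, N.le u z) → (∃ z ∈ c, N.le z v) → ¬ v ≤ u := by
    rintro u hu v hv ⟨z, hz, huz⟩ ⟨w, hw, hwv⟩ hvu
    have hwu : N.le w u := le_trans hwv hvu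
    by_cases hwz : w = z
    · subst hwz
      exact hcl w hw (le_antisymm hwu huz ▸ hu)
    · exact hc hw hz hwz (Or.inl (le_trans hwu huz))
  have hpq : p ≤ q := (hl.li hp hq).resolve_right (hsep p hp q hq hpc hqc)
  obtain ⟨a, ha⟩ := ((hfin p q).subset
    (t := {x | x ∈ N.interval p q ∧ x ∈ l ∧ ∃ z ∈ c, N.le x z})
    fun x hx => hx.1).exists_maximal ⟨p, ⟨le_refl p, hpq⟩, hp, hpc⟩
  obtain ⟨⟨hpa, haq⟩, hal, hac⟩ := ha.prop
  obtain ⟨b, hb⟩ := ((hfin a q).subset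
    (t := {x | x ∈ N.interval a q ∧ x ∈ l ∧ ∃ z ∈ c, N.le z x})
    fun x hx => hx.1).exists_minimal ⟨q, ⟨haq, le_refl q⟩, hq, hqc⟩
  obtain ⟨⟨hab, hbq⟩, hbl, hbc⟩ := hb.prop
  have hbetween : ∀ u ∈ l, N.le a u → N.le u b → N.le u a ∨ N.le b u := by
    intro u hu hau hub
    obtain ⟨z, hz, h | h⟩ := hli u hu
    · exact Or.inl (ha.le_of_ge
        ⟨⟨le_trans hpa hau, le_trans hub hbq⟩, hu, z, hz, h⟩ hau)
    · exact Or.inr (hb.le_of_le ⟨⟨hau, le_trans hub hbq⟩, hu, z, hz, h⟩ hub)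
  have hF : N.F a b := by
    rcases Relation.ReflTransGen.cases_head hab with h | ⟨w, haw, hwb⟩
    · exact (hsep a hal b hbl hac hbc (h ▸ le_refl a)).elim
    · have haw' : N.le a w := Relation.ReflTransGen.single haw
      have hwl : w ∈ l := hl.mem_of_forall_li fun u hu => by
        rcases hl.li hu hal with h | hau
        · exact Or.inr (le_trans h haw')
        rcases hl.li hu hbl with hub | h
        · rcases hbetween u hu hau hub with h | h
          · exact Or.inr (le_trans h haw')
          · exact Or.inl (le_trans hwb h)
        · exact Or.inl (le_trans hwb h)
      rcases hbetween w hwl haw' hwb with h | h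
      · exact (N.acyclic a (Relation.TransGen.head' haw h)).elim
      · exact le_antisymm hwb h ▸ haw
  rcases N.bipartite a b hF with ⟨haB, -⟩ | ⟨-, hbB⟩
  · obtain ⟨z, hz, haz⟩ := hac
    rcases Relation.ReflTransGen.cases_head haz with rfl | ⟨w, haw, hwz⟩
    · exact hcl _ hz hal
    · obtain rfl := N.succ_subsingleton a haB haw hF
      exact hsep _ hbl _ hbl ⟨z, hz, hwz⟩ hbc (le_refl _)
  · obtain ⟨z, hz, hzb⟩ := hbc
    rcases Relation.ReflTransGen.cases_tail hzb with rfl | ⟨w, hzw, hwb⟩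
    · exact hcl _ hz hbl
    · obtain rfl := N.pred_subsingleton b hbB hwb hF
      exact hsep _ hal _ hal hac ⟨z, hz, hzw⟩ (le_refl _)

theorem kDense_of_line_meets (hfin : ∀ x y, (N.interval x y).Finite)
    (h : ∀ A : Set α, N.Closed A → ∀ l : Set α, N.IsLine l →
      ((l ∩ A).Nonempty ∨ (l ∩ N.prime A).Nonempty)) : N.KDense := by
  intro c l hc hl
  have hmeets (S : Set α) := h (N.prime S) (closed_prime S) l hl
  have hne : l.Nonempty := (hmeets ∅).elim (·.left) (·.left)
  by_contra hcl
  have hcl' : ∀ z ∈ c, z ∉ l := fun z hz hzl => hcl ⟨z, hz, hzl⟩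
  by_cases hbelow : ∀ x ∈ l, ∃ z ∈ c, N.le x z
  · obtain ⟨S, h₁, h₂⟩ := exists_prime_disjoint_line hfin hc.1 hl hcl' hne hbelow
    exact (hmeets S).elim h₁ h₂
  by_cases habove : ∀ x ∈ l, ∃ z ∈ c, N.le z x
  · obtain ⟨S, h₁, h₂⟩ := exists_prime_disjoint_line (finite_interval_op hfin)
      (co_op (N := N) ▸ hc.1) (isLine_op.2 hl) hcl' hne (by simpa only [le_op] using habove)
    rw [prime_op] at h₁ h₂
    exact (hmeets S).elim h₁ h₂
  push Not at hbelow habove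
  obtain ⟨q, hq, hqc⟩ := hbelow
  obtain ⟨p, hp, hpc⟩ := habove
  obtain ⟨z, hz, hpz⟩ := hc.exists_li p
  obtain ⟨w, hw, hqw⟩ := hc.exists_li q
  exact hcl (hl.meets_of_le_of_le hfin hc.1 (fun x _ => hc.exists_li x) hp hq
    ⟨z, hz, hpz.resolve_right (hpc z hz)⟩ ⟨w, hw, hqw.resolve_left (hqc w hw)⟩)

end CausalNet

/-- A locally finite causal net is K-dense iff every line meets
every closed set or its orthocomplement. -/
theorem kDense_iff_line_meets_closed_or_prime {α : Type*} (N : CausalNet α)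
    (hLF : N.LocallyFinite) :
    N.KDense ↔ ∀ A : Set α, N.Closed A → ∀ l : Set α, N.IsLine l →
      ((l ∩ A).Nonempty ∨ (l ∩ N.prime A).Nonempty) := by
  exact ⟨fun hN _ hA _ hl => hN.line_meets hA hl, CausalNet.kDense_of_line_meets hLF.1⟩
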